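/- Let Ω = B(0,1) ⊂ ℝⁿ, n ≥ 3, let A be a (λ,Λ)-elliptic coefficient matrix, let B : Ω → ℝⁿ be a measurable drift with δ(x)^{1−β}|B(x)| ≤ M for all x ∈ Ω, and let G be a Green's function of L₁ = −div(A∇·) + B·∇ on Ω. Then there exists a constant K > 0, depending only on n, λ, Λ, M, β, such that for every y ∈ Ω and every 0 < r ≤ δ(y)/2: 1 ≤ K · r^{n−2} · sup { G(y,x) : x ∈ Ω, r/4 ≤ |x−y| ≤ 3r/2 }. -/

import Mathlib

open Set Metric MeasureTheory Filter
open scoped RealInnerProductSpace Topology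

noncomputable section

/-- Euclidean space `ℝⁿ`. -/
abbrev Euc (n : ℕ) := EuclideanSpace ℝ (Fin n)

/-- A `(λ, Λ)`-elliptic coefficient matrix on the unit ball:
`⟨A(x)η, η⟩ ≥ λ|η|²` and `|⟨A(x)η, ψ⟩| ≤ Λ|η||ψ|` for all `x ∈ Ω`, `η, ψ ∈ ℝⁿ`. -/
def IsElliptic {n : ℕ} (lam Lam : ℝ) (A : Euc n → Euc n →L[ℝ] Euc n) : Prop :=
  ∀ x ∈ ball (0 : Euc n) 1,
    (∀ η : Euc n, lam * ‖η‖ ^ 2 ≤ ⟪A x η, η⟫) ∧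
      ∀ η ψ : Euc n, |⟪A x η, ψ⟫| ≤ Lam * ‖η‖ * ‖ψ‖

/-- The drift bound `δ(x)^(1-β) |B(x)| ≤ M` on the unit ball, where `δ(x) = 1 - |x|`. -/
def DriftBound {n : ℕ} (β M : ℝ) (B : Euc n → Euc n) : Prop :=
  ∀ x ∈ ball (0 : Euc n) 1, (1 - ‖x‖) ^ (1 - β) * ‖B x‖ ≤ M

/-- A Green's function of `L₁ = -div(A∇·) + B·∇` on the unit ball `Ω = B(0,1)`:
`G > 0` off the diagonal, `G(y, ·)` is `C¹` away from `y` with `G(y,·)` and `|∇ₓG(y,·)|`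
locally integrable on `Ω`, and
`∫_Ω (⟨A∇φ, ∇ₓG(y,·)⟩ - G(y,·)⟨B, ∇φ⟩) = φ(y)` for every `φ ∈ C_c^∞(Ω)`, `y ∈ Ω`. -/
def IsGreenFn {n : ℕ} (A : Euc n → Euc n →L[ℝ] Euc n) (B : Euc n → Euc n)
    (G : Euc n → Euc n → ℝ) : Prop :=
  (∀ y ∈ ball (0 : Euc n) 1, ∀ x ∈ ball (0 : Euc n) 1, x ≠ y → 0 < G y x) ∧
  (∀ y ∈ ball (0 : Euc n) 1, ContDiffOn ℝ 1 (G y) (ball 0 1 \ {y})) ∧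
  (∀ y ∈ ball (0 : Euc n) 1, LocallyIntegrableOn (G y) (ball 0 1)) ∧
  (∀ y ∈ ball (0 : Euc n) 1,
    LocallyIntegrableOn (fun x => ‖gradient (G y) x‖) (ball 0 1)) ∧
  (∀ y ∈ ball (0 : Euc n) 1, ∀ φ : Euc n → ℝ,
    ContDiff ℝ (⊤ : ℕ∞) φ → HasCompactSupport φ → tsupport φ ⊆ ball 0 1 →
    (∫ x in ball (0 : Euc n) 1,
      (⟪A x (gradient φ x), gradient (G y) x⟫ - G y x * ⟪B x, gradient φ x⟫)) = φ y)

open scoped Convolution ContDiff in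
/-- A compactly supported `C¹` function is approximated in `C¹` norm by smooth functions
supported in any prescribed neighbourhood of its support. -/
theorem ContDiff.exists_contDiff_fderiv_le {E : Type*} [NormedAddCommGroup E] [NormedSpace ℝ E]
    [FiniteDimensional ℝ E] {f : E → ℝ} (hf : ContDiff ℝ 1 f) (hc : HasCompactSupport f)
    {ε δ : ℝ} (hε : 0 < ε) (hδ : 0 < δ) :
    ∃ g : E → ℝ, ContDiff ℝ ∞ g ∧ (∀ x, (∀ z ∈ ball x δ, f z = 0) → g x = 0) ∧
      ∀ x, ‖fderiv ℝ g x - fderiv ℝ f x‖ ≤ ε := by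
  borelize E
  let μ : Measure E := Measure.addHaar
  have hf' : Continuous (fderiv ℝ f) := hf.continuous_fderiv one_ne_zero
  have huc : UniformContinuous (fderiv ℝ f) := (hc.fderiv ℝ).uniformContinuous_of_continuous hf'
  obtain ⟨δ', hδ', H⟩ := Metric.uniformContinuous_iff.mp huc ε hε
  have hm : 0 < min δ δ' := lt_min hδ hδ'
  let φ : ContDiffBump (0 : E) := ⟨min δ δ' / 2, min δ δ', half_pos hm, half_lt_self hm⟩
  have hli : LocallyIntegrable f μ := hf.continuous.locallyIntegrable
  have hφli : LocallyIntegrable (φ.normed μ) μ := φ.continuous_normed.locallyIntegrable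
  refine ⟨φ.normed μ ⋆[ContinuousLinearMap.lsmul ℝ ℝ, μ] f, ?_, fun x hx => ?_, fun x => ?_⟩
  · exact φ.hasCompactSupport_normed.contDiff_convolution_left _ φ.contDiff_normed hli
  · have h0 : f x = 0 := hx x (mem_ball_self hδ)
    rw [φ.normed_convolution_eq_right, h0]
    intro z hz
    rw [h0, hx z (ball_subset_ball (min_le_left _ _) hz)]
  · have h1 := (hc.hasFDerivAt_convolution_right (ContinuousLinearMap.lsmul ℝ ℝ) hφli hf x).fderiv
    have h2 : (φ.normed μ ⋆[(ContinuousLinearMap.lsmul ℝ ℝ).precompR E, μ] fderiv ℝ f) x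
        = (φ.normed μ ⋆[ContinuousLinearMap.lsmul ℝ ℝ, μ] fderiv ℝ f) x := by
      rw [convolution_def, convolution_def]
      refine integral_congr_ae (Eventually.of_forall fun t => ?_)
      ext v
      simp [ContinuousLinearMap.precompR_apply]
    rw [h1, h2, ← dist_eq_norm]
    refine φ.dist_normed_convolution_le hf'.aestronglyMeasurable fun z hz => ?_
    exact (H (lt_of_lt_of_le (mem_ball.1 hz) (min_le_right _ _))).le

/-- Cutoff functions at scale `r` around `y`: a smooth `η` equal to `1` near `y` and supported in
`closedBall y r`, and a smooth `ζ` supported in an annulus and equal to `1` where `∇η ≠ 0`,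
both with gradients of size `1 / r`. -/
theorem exists_annular_cutoffs (E : Type*) [NormedAddCommGroup E] [InnerProductSpace ℝ E]
    [FiniteDimensional ℝ E] :
    ∃ C > (0 : ℝ), ∀ (y : E) (r : ℝ), 0 < r → ∃ η ζ : E → ℝ,
      ContDiff ℝ (⊤ : ℕ∞) η ∧ ContDiff ℝ (⊤ : ℕ∞) ζ ∧ η y = 1 ∧
      (∀ x, r < ‖x - y‖ → η x = 0) ∧ (∀ x, 0 ≤ ζ x) ∧ (∀ x, ζ x ≤ 1) ∧
      (∀ x, ‖x - y‖ < 3 * r / 10 → ζ x = 0) ∧ (∀ x, 5 * r / 4 < ‖x - y‖ → ζ x = 0) ∧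
      (∀ x, ‖fderiv ℝ η x‖ ≤ C / r * ζ x) ∧ (∀ x, ‖fderiv ℝ ζ x‖ ≤ C / r) := by
  let b₁ : ContDiffBump (0 : E) := ⟨1 / 2, 1, by norm_num, by norm_num⟩
  let b₂ : ContDiffBump (0 : E) := ⟨3 / 10, 1 / 2, by norm_num, by norm_num⟩
  let b₃ : ContDiffBump (0 : E) := ⟨1, 5 / 4, by norm_num, by norm_num⟩
  let z : E → ℝ := fun x => b₃ x * (1 - b₂ x)
  have hb₁ : ContDiff ℝ (⊤ : ℕ∞) b₁ := b₁.contDiff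
  have hz : ContDiff ℝ (⊤ : ℕ∞) z := b₃.contDiff.mul (contDiff_const.sub b₂.contDiff)
  have hzc : HasCompactSupport z := b₃.hasCompactSupport.mul_right
  obtain ⟨C₁, hC₁⟩ := (hb₁.continuous_fderiv (by simp)).bounded_above_of_compact_support
    (b₁.hasCompactSupport.fderiv ℝ)
  obtain ⟨C₂, hC₂⟩ := (hz.continuous_fderiv (by simp)).bounded_above_of_compact_support
    (hzc.fderiv ℝ)
  have hC : 0 < max (max C₁ C₂) 1 := lt_of_lt_of_le one_pos (le_max_right _ _)
  set C := max (max C₁ C₂) 1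
  have hC₁' : ∀ x, ‖fderiv ℝ b₁ x‖ ≤ C := fun x =>
    (hC₁ x).trans ((le_max_left _ _).trans (le_max_left _ _))
  have hC₂' : ∀ x, ‖fderiv ℝ z x‖ ≤ C := fun x =>
    (hC₂ x).trans ((le_max_right _ _).trans (le_max_left _ _))
  have hz0 : ∀ x, 0 ≤ z x := fun x => mul_nonneg b₃.nonneg (sub_nonneg.2 b₂.le_one)
  have hb₁z : ∀ x, ‖fderiv ℝ b₁ x‖ ≤ C * z x := by
    intro x
    by_cases h1 : ‖x‖ < 1 / 2
    · have : b₁ =ᶠ[𝓝 x] fun _ => (1 : ℝ) :=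
        b₁.eventuallyEq_one_of_mem_ball (by simpa [b₁] using h1)
      rw [this.fderiv_eq]
      simpa using mul_nonneg hC.le (hz0 x)
    by_cases h2 : 1 < ‖x‖
    · have : b₁ =ᶠ[𝓝 x] fun _ => (0 : ℝ) := by
        filter_upwards [(isOpen_lt continuous_const continuous_norm).mem_nhds h2] with w hw
        exact b₁.zero_of_le_dist (by simpa [b₁] using le_of_lt hw)
      rw [this.fderiv_eq]
      simpa using mul_nonneg hC.le (hz0 x)
    · have : z x = 1 := by
        have e3 : b₃ x = 1 := b₃.one_of_mem_closedBall (by simpa [b₃] using h2)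
        have e2 : b₂ x = 0 := b₂.zero_of_le_dist (by simpa [b₂] using h1)
        simp [z, e2, e3]
      rw [this, mul_one]
      exact hC₁' x
  refine ⟨C, hC, fun y r hr => ?_⟩
  have hr' : ∀ x, ‖r⁻¹ • (x - y)‖ = ‖x - y‖ / r := fun x => by
    rw [norm_smul, norm_inv, Real.norm_of_nonneg hr.le, inv_mul_eq_div]
  have hT : ContDiff ℝ (⊤ : ℕ∞) (fun x : E => r⁻¹ • (x - y)) := by fun_prop
  have hfd : ∀ f : E → ℝ, ContDiff ℝ (⊤ : ℕ∞) f → ∀ x,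
      ‖fderiv ℝ (fun x => f (r⁻¹ • (x - y))) x‖ = ‖fderiv ℝ f (r⁻¹ • (x - y))‖ / r := by
    intro f hf x
    have hd : HasFDerivAt (fun x : E => r⁻¹ • (x - y)) (r⁻¹ • ContinuousLinearMap.id ℝ E) x :=
      ((hasFDerivAt_id x).sub_const y).const_smul r⁻¹
    have := ((hf.differentiable (by simp) _).hasFDerivAt.comp x hd).fderiv
    rw [Function.comp_def] at this
    rw [this, ContinuousLinearMap.comp_smul, ContinuousLinearMap.comp_id, norm_smul, norm_inv,
      Real.norm_of_nonneg hr.le, inv_mul_eq_div]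
  refine ⟨fun x => b₁ (r⁻¹ • (x - y)), fun x => z (r⁻¹ • (x - y)), hb₁.comp hT, hz.comp hT,
    ?_, fun x hx => ?_, fun x => hz0 _, fun x => ?_, fun x hx => ?_, fun x hx => ?_, fun x => ?_,
    fun x => ?_⟩
  · exact b₁.one_of_mem_closedBall (by simp [b₁])
  · refine b₁.zero_of_le_dist ?_
    rw [dist_zero_right, hr', le_div_iff₀ hr]
    simpa [b₁] using hx.le
  · exact mul_le_one₀ b₃.le_one (sub_nonneg.2 b₂.le_one) (by linarith [b₂.nonneg' (r⁻¹ • (x - y))])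
  · have : b₂ (r⁻¹ • (x - y)) = 1 := by
      refine b₂.one_of_mem_closedBall ?_
      rw [mem_closedBall_zero_iff, hr', div_le_iff₀ hr]
      change _ ≤ 3 / 10 * r
      linarith
    simp [z, this]
  · have : b₃ (r⁻¹ • (x - y)) = 0 := by
      refine b₃.zero_of_le_dist ?_
      rw [dist_zero_right, hr', le_div_iff₀ hr]
      change 5 / 4 * r ≤ _
      linarith
    simp [z, this]
  · rw [hfd _ hb₁, div_mul_eq_mul_div]
    gcongr
    exact hb₁z _
  · rw [hfd _ hz]
    gcongr
    exact hC₂' _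

/-- The pointwise bound behind the Caccioppoli inequality: testing with `η - m⁻¹ ζ² g`, up to an
error `d` in the gradient, the quadratic term absorbs all terms linear in the gradient `p`. -/
theorem drift_form_le {E : Type*} [NormedAddCommGroup E] [InnerProductSpace ℝ E]
    {A : E →L[ℝ] E} {lam Lam m g ζ b c ε : ℝ} {p e z d B : E} (hlam : 0 < lam) (hLam : 0 ≤ Lam)
    (hA : ∀ v : E, lam * ‖v‖ ^ 2 ≤ ⟪A v, v⟫) (hA' : ∀ v w : E, |⟪A v, w⟫| ≤ Lam * ‖v‖ * ‖w‖)
    (hm : 0 < m) (hg : 0 ≤ g) (hgm : g ≤ m) (hζ0 : 0 ≤ ζ) (hζ1 : ζ ≤ 1)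
    (he : ‖e‖ ≤ c * ζ) (hz : ‖z‖ ≤ c) (hd : ‖d‖ ≤ ε) (hB : ‖B‖ ≤ b) :
    ⟪A (e - m⁻¹ • (ζ ^ 2 • p + (2 * ζ * g) • z + d)), p⟫
        - g * ⟪B, e - m⁻¹ • (ζ ^ 2 • p + (2 * ζ * g) • z + d)⟫
      ≤ m * ((3 * Lam * c + b) ^ 2 / (4 * lam) + 3 * b * c) + ε * (Lam * ‖p‖ / m + b) := by
  have hc : 0 ≤ c := (norm_nonneg z).trans hz
  have hb : 0 ≤ b := (norm_nonneg B).trans hB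
  have hε : 0 ≤ ε := (norm_nonneg d).trans hd
  have hp := norm_nonneg p
  have hgm1 : m⁻¹ * g ≤ 1 := by rw [inv_mul_le_iff₀ hm]; linarith
  have hgm0 : 0 ≤ m⁻¹ * g := by positivity
  set u := ζ * ‖p‖ with hu
  have hu0 : 0 ≤ u := by positivity
  have t1 : ⟪A e, p⟫ ≤ Lam * c * u := by
    calc ⟪A e, p⟫ ≤ Lam * ‖e‖ * ‖p‖ := (le_abs_self _).trans (hA' e p)
      _ ≤ Lam * (c * ζ) * ‖p‖ := by gcongr
      _ = Lam * c * u := by rw [hu]; ring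
  have t2 : lam / m * u ^ 2 ≤ m⁻¹ * ζ ^ 2 * ⟪A p, p⟫ := by
    calc lam / m * u ^ 2 = m⁻¹ * ζ ^ 2 * (lam * ‖p‖ ^ 2) := by rw [hu]; ring
      _ ≤ _ := by gcongr; exact hA p
  have t3 : -(2 * Lam * c * u) ≤ 2 * ζ * (m⁻¹ * g) * ⟪A z, p⟫ := by
    have h1 : -(Lam * c * ‖p‖) ≤ ⟪A z, p⟫ := by
      refine le_trans (neg_le_neg ?_) (neg_abs_le _)
      exact (hA' z p).trans (by gcongr)
    calc -(2 * Lam * c * u) = 2 * ζ * 1 * -(Lam * c * ‖p‖) := by rw [hu]; ring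
      _ ≤ 2 * ζ * (m⁻¹ * g) * -(Lam * c * ‖p‖) := by
        refine mul_le_mul_of_nonpos_right (by gcongr) (neg_nonpos.2 (by positivity))
      _ ≤ _ := by gcongr
  have t4 : -(ε * (Lam * ‖p‖ / m)) ≤ m⁻¹ * ⟪A d, p⟫ := by
    have h1 : -(Lam * ε * ‖p‖) ≤ ⟪A d, p⟫ := by
      refine le_trans (neg_le_neg ?_) (neg_abs_le _)
      exact (hA' d p).trans (by gcongr)
    calc -(ε * (Lam * ‖p‖ / m)) = m⁻¹ * -(Lam * ε * ‖p‖) := by ring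
      _ ≤ _ := by gcongr
  have hBi : ∀ v : E, |⟪B, v⟫| ≤ b * ‖v‖ := fun v =>
    (abs_real_inner_le_norm B v).trans (by gcongr)
  have t5 : -(m * b * c) ≤ g * ⟪B, e⟫ := by
    have h1 : |g * ⟪B, e⟫| ≤ m * (b * c) := by
      rw [abs_mul, abs_of_nonneg hg]
      have : ‖e‖ ≤ c := he.trans (mul_le_of_le_one_right hc hζ1)
      have := (hBi e).trans (mul_le_mul_of_nonneg_left this hb)
      gcongr
    linarith [neg_abs_le (g * ⟪B, e⟫)]
  have t6 : (m⁻¹ * g) * ζ ^ 2 * ⟪B, p⟫ ≤ b * u := by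
    calc (m⁻¹ * g) * ζ ^ 2 * ⟪B, p⟫ ≤ (m⁻¹ * g) * ζ ^ 2 * (b * ‖p‖) := by
          gcongr; exact (le_abs_self _).trans (hBi p)
      _ ≤ 1 * ζ * (b * ‖p‖) := by
          have : ζ ^ 2 ≤ ζ := by nlinarith
          gcongr
      _ = b * u := by rw [hu]; ring
  have t7 : (m⁻¹ * g) * (2 * ζ * g) * ⟪B, z⟫ ≤ 2 * m * b * c := by
    have h1 : ⟪B, z⟫ ≤ b * c := (le_abs_self _).trans ((hBi z).trans (by gcongr))
    calc (m⁻¹ * g) * (2 * ζ * g) * ⟪B, z⟫ ≤ (m⁻¹ * g) * (2 * ζ * g) * (b * c) := by gcongr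
      _ ≤ 1 * (2 * 1 * m) * (b * c) := by gcongr
      _ = 2 * m * b * c := by ring
  have t8 : (m⁻¹ * g) * ⟪B, d⟫ ≤ ε * b := by
    have h1 : ⟪B, d⟫ ≤ b * ε := (le_abs_self _).trans ((hBi d).trans (by gcongr))
    calc (m⁻¹ * g) * ⟪B, d⟫ ≤ (m⁻¹ * g) * (b * ε) := by gcongr
      _ ≤ 1 * (b * ε) := by gcongr
      _ = ε * b := by ring
  have t9 : (3 * Lam * c + b) * u - lam / m * u ^ 2
      ≤ m * ((3 * Lam * c + b) ^ 2 / (4 * lam)) := by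
    have : m * ((3 * Lam * c + b) ^ 2 / (4 * lam))
        - ((3 * Lam * c + b) * u - lam / m * u ^ 2)
        = (m * (3 * Lam * c + b) - 2 * lam * u) ^ 2 / (4 * lam * m) := by
      field_simp
      ring
    have h2 : 0 ≤ (m * (3 * Lam * c + b) - 2 * lam * u) ^ 2 / (4 * lam * m) := by positivity
    linarith
  simp only [map_sub, map_add, map_smul, inner_sub_left, inner_add_left, inner_smul_left,
    inner_sub_right, inner_add_right, inner_smul_right, RCLike.conj_to_real]
  linarith

theorem gradient_sub_smul {E : Type*} [NormedAddCommGroup E] [InnerProductSpace ℝ E]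
    [CompleteSpace E] {f g : E → ℝ} {x : E} (hf : DifferentiableAt ℝ f x)
    (hg : DifferentiableAt ℝ g x) (c : ℝ) :
    gradient (fun w => f w - c * g w) x = gradient f x - c • gradient g x := by
  simp only [gradient]
  rw [fderiv_fun_sub hf (hg.const_mul c), fderiv_const_mul hg, map_sub, map_smul]

theorem gradient_sq_mul {E : Type*} [NormedAddCommGroup E] [InnerProductSpace ℝ E]
    [CompleteSpace E] {f g : E → ℝ} {x : E} (hf : DifferentiableAt ℝ f x)
    (hg : DifferentiableAt ℝ g x) :
    gradient (fun w => f w ^ 2 * g w) x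
      = f x ^ 2 • gradient g x + (2 * f x * g x) • gradient f x := by
  have h := ((hf.hasFDerivAt.pow 2).mul hg.hasFDerivAt).fderiv
  have h' : fderiv ℝ (fun w => f w ^ 2 * g w) x
      = f x ^ 2 • fderiv ℝ g x + (2 * f x * g x) • fderiv ℝ f x := by
    refine h.trans ?_
    ext v
    simp
    ring
  simp only [gradient]
  rw [h', map_add, map_smul, map_smul]

theorem norm_gradient {E : Type*} [NormedAddCommGroup E] [InnerProductSpace ℝ E]
    [CompleteSpace E] (f : E → ℝ) (x : E) : ‖gradient f x‖ = ‖fderiv ℝ f x‖ :=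
  LinearIsometryEquiv.norm_map _ _

theorem norm_gradient_sub {E : Type*} [NormedAddCommGroup E] [InnerProductSpace ℝ E]
    [CompleteSpace E] (f g : E → ℝ) (x : E) :
    ‖gradient f x - gradient g x‖ = ‖fderiv ℝ f x - fderiv ℝ g x‖ := by
  simp only [gradient]
  rw [← map_sub, LinearIsometryEquiv.norm_map]

/-- The drift is at most `2M/r` at points of the unit ball at distance at least `r/2` from the
boundary, if `r ≤ 2`. -/
theorem DriftBound.norm_le {n : ℕ} {β M r : ℝ} {B : Euc n → Euc n} (h : DriftBound β M B)
    (hβ0 : 0 < β) (hβ1 : β < 1) (hr : 0 < r) (hr1 : r ≤ 2) {x : Euc n}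
    (hx : r / 2 ≤ 1 - ‖x‖) : ‖B x‖ ≤ 2 * M / r := by
  have h1 := h x (by rw [mem_ball_zero_iff]; linarith)
  have h2 : r / 2 ≤ (1 - ‖x‖) ^ (1 - β) :=
    calc r / 2 = (r / 2) ^ (1 : ℝ) := (Real.rpow_one _).symm
      _ ≤ (r / 2) ^ (1 - β) :=
        Real.rpow_le_rpow_of_exponent_ge (by positivity) (by linarith) (by linarith)
      _ ≤ (1 - ‖x‖) ^ (1 - β) := Real.rpow_le_rpow (by positivity) hx (by linarith)
  have h3 : r / 2 * ‖B x‖ ≤ M := (mul_le_mul_of_nonneg_right h2 (norm_nonneg _)).trans h1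
  rw [le_div_iff₀ hr]
  linarith

/-- normalization lower bound:
`1 ≤ K r^{n-2} sup {G(y,x) : x ∈ Ω, r/4 ≤ |x-y| ≤ 3r/2}` for `0 < r ≤ δ(y)/2`,
with `K` depending only on `n`, `λ`, `Λ`, `M`, `β`. -/
theorem green_sup_lower_bound
    (n : ℕ) (hn : 3 ≤ n) (β M lam Lam : ℝ)
    (hβ0 : 0 < β) (hβ1 : β < 1) (hM : 0 < M) (hlam : 0 < lam) (hLam : lam ≤ Lam) :
    ∃ K > (0 : ℝ), ∀ (A : Euc n → Euc n →L[ℝ] Euc n) (B : Euc n → Euc n)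
      (G : Euc n → Euc n → ℝ),
      IsElliptic lam Lam A → Measurable B → DriftBound β M B → IsGreenFn A B G →
      ∀ y ∈ ball (0 : Euc n) 1, ∀ r : ℝ, 0 < r → r ≤ (1 - ‖y‖) / 2 →
        1 ≤ K * r ^ (n - 2) *
          sSup (G y '' {x : Euc n |
            x ∈ ball (0 : Euc n) 1 ∧ r / 4 ≤ ‖x - y‖ ∧ ‖x - y‖ ≤ 3 * r / 2}) := by
  obtain ⟨C, hC, hcut⟩ := exists_annular_cutoffs (Euc n)
  have hLam0 : 0 < Lam := hlam.trans_le hLam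
  set K₁ : ℝ := (3 * Lam * C + 2 * M) ^ 2 / (4 * lam) + 6 * M * C + 1 with hK₁
  have hK₁0 : 0 < K₁ := by positivity
  refine ⟨K₁ * (3 / 2) ^ n * volume.real (ball (0 : Euc n) 1) + 1, by positivity, ?_⟩
  intro A B G hA _ hB ⟨hGpos, hGC, _, _, hGint⟩ y hy r hr hry
  have hyn : 0 ≤ ‖y‖ := norm_nonneg y
  have : Nontrivial (Euc n) := by
    have : Nonempty (Fin n) := ⟨⟨0, by omega⟩⟩
    infer_instance
  set S : Set (Euc n) := {x : Euc n |
    x ∈ ball (0 : Euc n) 1 ∧ r / 4 ≤ ‖x - y‖ ∧ ‖x - y‖ ≤ 3 * r / 2} with hS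
  have hdist : ∀ x : Euc n, ‖x - y‖ ≤ 3 * r / 2 → r / 2 ≤ 1 - ‖x‖ := fun x hx => by
    have := norm_le_norm_add_norm_sub' x y
    linarith
  have hball : ∀ x : Euc n, ‖x - y‖ ≤ 3 * r / 2 → x ∈ ball (0 : Euc n) 1 := fun x hx => by
    rw [mem_ball_zero_iff]
    linarith [hdist x hx]
  have hSeq : S = {x : Euc n | r / 4 ≤ ‖x - y‖ ∧ ‖x - y‖ ≤ 3 * r / 2} :=
    Set.ext fun x => ⟨fun h => h.2, fun h => ⟨hball x h.2, h⟩⟩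
  have hSclosed : IsClosed S := by
    rw [hSeq]
    have hcont : Continuous fun x : Euc n => ‖x - y‖ := by fun_prop
    exact (isClosed_le continuous_const hcont).inter (isClosed_le hcont continuous_const)
  have hScomp : IsCompact S := by
    refine (isCompact_closedBall y (3 * r / 2)).of_isClosed_subset hSclosed fun x hx => ?_
    rw [mem_closedBall, dist_eq_norm]
    exact hx.2.2
  have hSU : S ⊆ ball (0 : Euc n) 1 \ {y} := fun x hx => by
    refine ⟨hx.1, fun h => ?_⟩
    rw [mem_singleton_iff] at h
    have := hx.2.1
    rw [h, sub_self, norm_zero] at this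
    linarith
  have hUopen : IsOpen (ball (0 : Euc n) 1 \ {y}) := isOpen_ball.sdiff isClosed_singleton
  have hGat : ∀ x ∈ S, ContDiffAt ℝ 1 (G y) x := fun x hx =>
    (hGC y hy).contDiffAt (hUopen.mem_nhds (hSU hx))
  have hbdd : BddAbove (G y '' S) := hScomp.bddAbove_image ((hGC y hy).continuousOn.mono hSU)
  set m := sSup (G y '' S) with hm
  have hle : ∀ x ∈ S, G y x ≤ m := fun x hx => le_csSup hbdd (mem_image_of_mem _ hx)
  have hpos : ∀ x ∈ S, 0 < G y x := fun x hx => hGpos y hy x hx.1 (hSU hx).2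
  have hm0 : 0 < m := by
    obtain ⟨v, hv⟩ := exists_norm_eq (Euc n) hr.le
    have hx : y + v ∈ S := by
      rw [hSeq, mem_ofPred_eq, add_sub_cancel_left, hv]
      constructor <;> linarith
    exact (hpos _ hx).trans_le (hle _ hx)
  obtain ⟨P, hP⟩ := hScomp.exists_bound_of_continuousOn
    (((hGC y hy).continuousOn_fderiv_of_isOpen hUopen le_rfl).mono hSU)
  obtain ⟨η, ζ, hη, hζ, hηy, hη0, hζ0, hζ1, hζin, hζout, hdη, hdζ⟩ := hcut y r hr
  set f : Euc n → ℝ := fun w => ζ w ^ 2 * G y w with hf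
  have hf0 : ∀ x, ζ x = 0 → f x = 0 := fun x hx => by simp [hf, hx]
  have hnear : ∀ x ∉ S, ∀ z ∈ ball x (r / 20), f z = 0 := by
    intro x hx z hz
    rw [mem_ball, dist_eq_norm] at hz
    have h1 : ‖z - y‖ ≤ ‖x - y‖ + ‖z - x‖ := by
      have := norm_add_le (z - x) (x - y)
      rwa [sub_add_sub_cancel, add_comm] at this
    have h2 : ‖x - y‖ ≤ ‖z - y‖ + ‖z - x‖ := by
      have := norm_sub_le (z - y) (z - x)
      rwa [sub_sub_sub_cancel_left] at this
    by_cases h : ‖x - y‖ < r / 4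
    · exact hf0 z (hζin z (by linarith))
    · have h3 : 3 * r / 2 < ‖x - y‖ := by
        by_contra h3
        exact hx (by rw [hSeq]; exact ⟨not_lt.1 h, not_lt.1 h3⟩)
      exact hf0 z (hζout z (by linarith))
  have hr20 : 0 < r / 20 := by positivity
  have hftS : tsupport f ⊆ S := closure_minimal (fun x hx => by
    by_contra h
    exact hx (hnear x h x (mem_ball_self hr20))) hSclosed
  have hfC : ContDiff ℝ 1 f := contDiff_iff_contDiffAt.2 fun x => by
    by_cases hx : x ∈ S
    · exact ((hζ.of_le (by simp)).contDiffAt.pow 2).mul (hGat x hx)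
    · refine (contDiffAt_const (c := (0 : ℝ))).congr_of_eventuallyEq ?_
      filter_upwards [hSclosed.isOpen_compl.mem_nhds hx] with w hw
      exact hnear w hw w (mem_ball_self hr20)
  have hfc : HasCompactSupport f := hScomp.of_isClosed_subset (isClosed_tsupport f) hftS
  set ε : ℝ := m / r ^ 2 / (Lam * |P| / m + 2 * M / r) with hε
  have hden : 0 < Lam * |P| / m + 2 * M / r := by positivity
  have hε0 : 0 < ε := by positivity
  obtain ⟨ψ, hψ, hψ0, hψd⟩ := hfC.exists_contDiff_fderiv_le hfc hε0 hr20
  have hψS : ∀ x ∉ S, ψ x = 0 := fun x hx => hψ0 x (hnear x hx)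
  have hyS : y ∉ S := fun h => (hSU h).2 rfl
  set φ : Euc n → ℝ := fun w => η w - m⁻¹ * ψ w with hφdef
  have hφ : ContDiff ℝ (⊤ : ℕ∞) φ := hη.sub (contDiff_const.mul hψ)
  have hφy : φ y = 1 := by simp [hφdef, hηy, hψS y hyS]
  have hφsupp : tsupport φ ⊆ closedBall y (3 * r / 2) := closure_minimal (fun x hx => by
    by_contra h
    rw [mem_closedBall, dist_eq_norm, not_le] at h
    have h1 : ψ x = 0 := hψS x fun hxS => by linarith [hxS.2.2]
    exact hx (by simp [hφdef, hη0 x (by linarith), h1])) isClosed_closedBall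
  have hcB : closedBall y (3 * r / 2) ⊆ ball (0 : Euc n) 1 := fun x hx => by
    rw [mem_closedBall, dist_eq_norm] at hx
    exact hball x hx
  have hint := hGint y hy φ hφ
    ((isCompact_closedBall y (3 * r / 2)).of_isClosed_subset (isClosed_tsupport φ) hφsupp)
    (hφsupp.trans hcB)
  rw [hφy] at hint
  have hgradφ : ∀ x, gradient φ x = gradient η x - m⁻¹ • gradient ψ x := fun x =>
    gradient_sub_smul (hη.differentiable (by simp) x) (hψ.differentiable (by simp) x) _
  have hoff : ∀ x ∉ S, gradient φ x = 0 := by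
    intro x hx
    have h1 : gradient ψ x = 0 := by
      have : ψ =ᶠ[𝓝 x] fun _ => (0 : ℝ) := by
        filter_upwards [hSclosed.isOpen_compl.mem_nhds hx] with w hw using hψS w hw
      rw [← norm_eq_zero, norm_gradient, this.fderiv_eq]
      simp
    have h2 : gradient η x = 0 := by
      have hz : ζ x = 0 := by
        by_cases h : ‖x - y‖ < r / 4
        · exact hζin x (by linarith)
        · refine hζout x ?_
          by_contra h3
          exact hx (by rw [hSeq]; exact ⟨not_lt.1 h, by linarith⟩)
      have := hdη x
      rw [hz, mul_zero, ← norm_gradient] at this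
      exact norm_le_zero_iff.1 this
    rw [hgradφ, h1, h2]
    simp
  have hon : ∀ x ∈ S, ⟪A x (gradient φ x), gradient (G y) x⟫ - G y x * ⟪B x, gradient φ x⟫
      ≤ m / r ^ 2 * K₁ := by
    intro x hx
    have hfx : gradient f x = ζ x ^ 2 • gradient (G y) x + (2 * ζ x * G y x) • gradient ζ x :=
      gradient_sq_mul (hζ.differentiable (by simp) x)
        ((hGat x hx).differentiableAt one_ne_zero)
    have hgr : gradient φ x = gradient η x - m⁻¹ • (ζ x ^ 2 • gradient (G y) x
        + (2 * ζ x * G y x) • gradient ζ x + (gradient ψ x - gradient f x)) := by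
      rw [hgradφ, ← hfx, add_sub_cancel]
    have hAx := hA x hx.1
    have key := drift_form_le (A := A x) (p := gradient (G y) x) (e := gradient η x)
      (z := gradient ζ x) (d := gradient ψ x - gradient f x) (B := B x) (c := C / r)
      (b := 2 * M / r) (ε := ε) hlam hLam0.le hAx.1 hAx.2 hm0 (hpos x hx).le (hle x hx)
      (hζ0 x) (hζ1 x) (by rw [norm_gradient]; exact hdη x) (by rw [norm_gradient]; exact hdζ x)
      (by rw [norm_gradient_sub]; exact hψd x)
      (hB.norm_le hβ0 hβ1 hr (by linarith) (hdist x hx.2.2))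
    rw [hgr]
    refine key.trans ?_
    have h1 : ε * (Lam * ‖gradient (G y) x‖ / m + 2 * M / r) ≤ m / r ^ 2 := by
      calc ε * (Lam * ‖gradient (G y) x‖ / m + 2 * M / r)
          ≤ ε * (Lam * |P| / m + 2 * M / r) := by
            have : ‖gradient (G y) x‖ ≤ |P| := by
              rw [norm_gradient]
              exact (hP x hx).trans (le_abs_self P)
            gcongr
        _ = m / r ^ 2 := div_mul_cancel₀ _ hden.ne'
    have h2 : m * ((3 * Lam * (C / r) + 2 * M / r) ^ 2 / (4 * lam) + 3 * (2 * M / r) * (C / r))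
        + m / r ^ 2 = m / r ^ 2 * K₁ := by
      rw [hK₁]
      field_simp
      ring
    linarith
  have hI : IntegrableOn (fun x => ⟪A x (gradient φ x), gradient (G y) x⟫
      - G y x * ⟪B x, gradient φ x⟫) (ball (0 : Euc n) 1) := by
    by_contra h
    rw [integral_undef h] at hint
    exact zero_ne_one hint
  have hmK : 0 ≤ m / r ^ 2 * K₁ := by positivity
  have hJ : IntegrableOn ((closedBall y (3 * r / 2)).indicator fun _ => m / r ^ 2 * K₁)
      (ball (0 : Euc n) 1) := by
    refine Integrable.integrableOn ?_
    exact (integrable_indicator_iff measurableSet_closedBall).2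
      (integrableOn_const measure_closedBall_lt_top.ne)
  have hmono := setIntegral_mono_on hI hJ measurableSet_ball fun x _ => by
    by_cases hx : x ∈ S
    · have hx' : x ∈ closedBall y (3 * r / 2) := by
        rw [mem_closedBall, dist_eq_norm]
        exact hx.2.2
      rw [indicator_of_mem hx']
      exact hon x hx
    · rw [hoff x hx]
      simpa using indicator_nonneg (fun _ _ => hmK) x
  rw [hint, setIntegral_indicator measurableSet_closedBall, inter_eq_self_of_subset_right hcB,
    setIntegral_const, Measure.addHaar_real_closedBall _ _ (by positivity), smul_eq_mul,
    finrank_euclideanSpace_fin] at hmono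
  refine hmono.trans ?_
  obtain ⟨k, rfl⟩ : ∃ k, n = k + 2 := ⟨n - 2, by omega⟩
  rw [Nat.add_sub_cancel]
  have hfin : (3 * r / 2) ^ (k + 2) * volume.real (ball (0 : Euc (k + 2)) 1) * (m / r ^ 2 * K₁)
      = K₁ * (3 / 2) ^ (k + 2) * volume.real (ball (0 : Euc (k + 2)) 1) * r ^ k * m := by
    rw [mul_div_right_comm, mul_pow, pow_add r]
    field_simp
  rw [hfin]
  have : 0 ≤ r ^ k * m := by positivity
  linarith
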